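/- arXiv:2404.14493 — 2 statements merged into one kernel-verified Lean document; each statement's English description precedes it below -/
import Mathlib

section
/- Let d ≥ 1 and let μ be the Haar probability measure on the unitary group U(d) of d×d complex unitary matrices. Let e₀ denote a fixed standard basis vector of ℂ^d. Then the expected value over U ~ μ of the largest squared amplitude of the Haar-random unit vector U e₀ equals the scaled harmonic number: E_U[ max_{0 ≤ i < d} |⟨e_i, U e₀⟩|² ] = (1/d) · ∑_{k=1}^{d} (1/k). In particular, for d = 4 (a Haar-random two-qubit state), this expected maximum output probability equals 25/48. -/
open Matrix MeasureTheory

/-- The standard complex Gaussian measure, with density `π⁻¹ exp (-‖z‖²)`. -/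
noncomputable def complexGaussian : Measure ℂ :=
  volume.withDensity fun z => ENNReal.ofReal (Real.exp (-‖z‖ ^ 2) / Real.pi)

theorem integrable_exp_neg_norm_sq_div_pi :
    Integrable fun z : ℂ => Real.exp (-‖z‖ ^ 2) / Real.pi := by
  have := (GaussianFourier.integrable_cexp_neg_mul_sq_norm_add (V := ℂ) (b := 1) (by simp) 0 0).norm
  refine (this.div_const Real.pi).congr (.of_forall fun z => ?_)
  simp [Complex.norm_exp, ← Complex.ofReal_pow]

theorem integral_Ioi_mul_exp_neg_sq (t : ℝ) (ht : 0 ≤ t) :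
    ∫ y in Set.Ioi (√t), y * Real.exp (-y ^ 2) = Real.exp (-t) / 2 := by
  have h := integral_Ioi_of_hasDerivAt_of_nonneg' (a := √t) (l := 0)
    (g := fun y : ℝ => -(Real.exp (-y ^ 2) / 2)) (g' := fun y => y * Real.exp (-y ^ 2)) ?_ ?_ ?_
  · rw [h, Real.sq_sqrt ht]; ring
  · intro x _
    convert! (((hasDerivAt_pow 2 x).neg.exp).div_const 2).neg using 1
    push_cast
    simp
    ring
  · intro x hx
    have : 0 ≤ x := (Real.sqrt_nonneg t).trans (le_of_lt hx)
    positivity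
  · have := ((Real.tendsto_exp_atBot.comp (Filter.tendsto_neg_atTop_atBot.comp
      (Filter.tendsto_pow_atTop (α := ℝ) two_ne_zero))).div_const 2).neg
    simpa using this

theorem complexGaussian_norm_sq_gt {t : ℝ} (ht : 0 ≤ t) :
    complexGaussian {z | t < ‖z‖ ^ 2} = ENNReal.ofReal (Real.exp (-t)) := by
  have hm : MeasurableSet {z : ℂ | t < ‖z‖ ^ 2} :=
    measurableSet_lt measurable_const (by fun_prop)
  rw [complexGaussian, withDensity_apply _ hm,
    ← ofReal_integral_eq_lintegral_ofReal integrable_exp_neg_norm_sq_div_pi.integrableOn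
      (.of_forall fun z => by positivity), ← integral_indicator hm]
  congr 1
  have h := integral_fun_norm_addHaar (volume : Measure ℂ)
    ({y : ℝ | t < y ^ 2}.indicator fun y => Real.exp (-y ^ 2) / Real.pi)
  have h1 : ∀ z : ℂ, {y : ℝ | t < y ^ 2}.indicator (fun y => Real.exp (-y ^ 2) / Real.pi) ‖z‖ =
    {z : ℂ | t < ‖z‖ ^ 2}.indicator (fun z => Real.exp (-‖z‖ ^ 2) / Real.pi) z := fun z => by
    simp [Set.indicator]
  simp only [h1] at h
  have h2 : ∀ y : ℝ, y ^ (Module.finrank ℝ ℂ - 1) •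
      {y : ℝ | t < y ^ 2}.indicator (fun y => Real.exp (-y ^ 2) / Real.pi) y =
      {y : ℝ | t < y ^ 2}.indicator (fun y => y * Real.exp (-y ^ 2) / Real.pi) y := fun y => by
    simp [Set.indicator, Complex.finrank_real_complex, mul_div_assoc]
  have hm' : MeasurableSet {y : ℝ | t < y ^ 2} :=
    measurableSet_lt measurable_const (by fun_prop)
  have hset : {y : ℝ | t < y ^ 2} ∩ Set.Ioi 0 = Set.Ioi (√t) := by
    ext y
    simp only [Set.mem_inter_iff, Set.mem_ofPred_eq, Set.mem_Ioi]
    constructor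
    · rintro ⟨h1, h2⟩
      exact (Real.sqrt_lt' h2).2 h1
    · intro h1
      have h2 := (Real.sqrt_nonneg t).trans_lt h1
      exact ⟨(Real.sqrt_lt' h2).1 h1, h2⟩
  simp only [h2] at h
  rw [h, integral_indicator hm', Measure.restrict_restrict hm', hset, integral_div,
    integral_Ioi_mul_exp_neg_sq t ht, Measure.real, Complex.volume_ball,
    Complex.finrank_real_complex]
  simp
  field_simp

instance : NullSingletonClass complexGaussian := by
  unfold complexGaussian; infer_instance

instance : IsProbabilityMeasure complexGaussian where
  measure_univ := by
    have h : (Set.univ : Set ℂ) =ᵐ[complexGaussian] {z : ℂ | 0 < ‖z‖ ^ 2} := by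
      filter_upwards [Measure.ae_ne complexGaussian 0] with z hz
      have : 0 < ‖z‖ ^ 2 := by positivity
      exact propext ⟨fun _ => this, fun _ => trivial⟩
    rw [measure_congr h, complexGaussian_norm_sq_gt le_rfl]
    simp

theorem complexGaussian_norm_sq_le {t : ℝ} (ht : 0 ≤ t) :
    complexGaussian {z | ‖z‖ ^ 2 ≤ t} = ENNReal.ofReal (1 - Real.exp (-t)) := by
  have hm : MeasurableSet {z : ℂ | t < ‖z‖ ^ 2} :=
    measurableSet_lt measurable_const (by fun_prop)
  have : {z : ℂ | ‖z‖ ^ 2 ≤ t} = {z : ℂ | t < ‖z‖ ^ 2}ᶜ := by ext; simp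
  rw [this, prob_compl_eq_one_sub hm, complexGaussian_norm_sq_gt ht,
    ENNReal.ofReal_sub _ (Real.exp_pos _).le, ENNReal.ofReal_one]

theorem lintegral_Ioi_one_sub_exp_neg_pow_mul_exp_neg (n : ℕ) :
    ∫⁻ t in Set.Ioi (0 : ℝ), ENNReal.ofReal ((1 - Real.exp (-t)) ^ n * Real.exp (-t)) =
      ENNReal.ofReal (1 / (n + 1)) := by
  have hderiv : ∀ x ∈ Set.Ici (0 : ℝ),
      HasDerivAt (fun t : ℝ => (1 - Real.exp (-t)) ^ (n + 1) / (n + 1))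
        ((1 - Real.exp (-x)) ^ n * Real.exp (-x)) x := by
    intro x _
    convert! (((hasDerivAt_neg x).exp.const_sub 1).pow (n + 1)).div_const ((n : ℝ) + 1) using 1
    push_cast
    field_simp
  have hnn : ∀ x ∈ Set.Ioi (0 : ℝ), 0 ≤ (1 - Real.exp (-x)) ^ n * Real.exp (-x) := by
    intro x hx
    have : Real.exp (-x) ≤ 1 := Real.exp_le_one_iff.2 (by simpa using hx.le)
    have := sub_nonneg.2 this
    positivity
  have hlim : Filter.Tendsto (fun t : ℝ => (1 - Real.exp (-t)) ^ (n + 1) / (n + 1)) Filter.atTop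
      (nhds (1 / (n + 1))) := by
    have := ((((Real.tendsto_exp_neg_atTop_nhds_zero).const_sub 1).pow (n + 1)).div_const
      ((n : ℝ) + 1))
    simpa using this
  rw [← ofReal_integral_eq_lintegral_ofReal
      (integrableOn_Ioi_deriv_of_nonneg' hderiv hnn hlim)
      ((ae_restrict_mem measurableSet_Ioi).mono hnn),
    integral_Ioi_of_hasDerivAt_of_nonneg' hderiv hnn hlim]
  simp

theorem lintegral_Ioi_one_sub_one_sub_exp_neg_pow (n : ℕ) :
    ∫⁻ t in Set.Ioi (0 : ℝ), ENNReal.ofReal (1 - (1 - Real.exp (-t)) ^ n) =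
      ENNReal.ofReal (∑ k ∈ Finset.range n, 1 / ((k : ℝ) + 1)) := by
  induction n with
  | zero => simp
  | succ n ih =>
    rw [Finset.sum_range_succ, ENNReal.ofReal_add (by positivity) (by positivity), ← ih,
      ← lintegral_Ioi_one_sub_exp_neg_pow_mul_exp_neg, ← lintegral_add_left (by fun_prop)]
    refine setLIntegral_congr_fun measurableSet_Ioi fun t ht => ?_
    have h1 : Real.exp (-t) ≤ 1 := Real.exp_le_one_iff.2 (by simpa using le_of_lt ht)
    have h2 := sub_nonneg.2 h1
    have h3 : (1 - Real.exp (-t)) ^ n ≤ 1 := pow_le_one₀ h2 (by linarith [Real.exp_pos (-t)])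
    rw [← ENNReal.ofReal_add (by linarith) (by positivity)]
    congr 1
    ring

theorem lintegral_norm_sq_complexGaussian :
    ∫⁻ z, ENNReal.ofReal (‖z‖ ^ 2) ∂complexGaussian = 1 := by
  rw [lintegral_eq_lintegral_meas_lt _ (.of_forall fun z => by positivity) (by fun_prop),
    setLIntegral_congr_fun measurableSet_Ioi
      fun t ht => complexGaussian_norm_sq_gt (le_of_lt ht)]
  simpa using lintegral_Ioi_one_sub_exp_neg_pow_mul_exp_neg 0

/-- The largest squared modulus of a coordinate. -/
noncomputable def peakWeight {ι : Type*} [Fintype ι] [Nonempty ι] (v : ι → ℂ) : ℝ :=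
  Finset.univ.sup' Finset.univ_nonempty fun i => ‖v i‖ ^ 2

section

variable {ι : Type*} [Fintype ι]

theorem peakWeight_nonneg [Nonempty ι] (v : ι → ℂ) : 0 ≤ peakWeight v :=
  Finset.le_sup'_of_le _ (Finset.mem_univ (Classical.arbitrary ι)) (by positivity)

theorem continuous_peakWeight [Nonempty ι] : Continuous (peakWeight (ι := ι)) := by
  unfold peakWeight
  exact Continuous.finset_sup'_apply _ fun i _ => by fun_prop

theorem peakWeight_smul [Nonempty ι] (c : ℂ) (v : ι → ℂ) :
    peakWeight (c • v) = ‖c‖ ^ 2 * peakWeight v := by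
  simp only [peakWeight, Pi.smul_apply, norm_smul, mul_pow]
  exact (Finset.mul₀_sup' (by positivity) _ _ _).symm

theorem lintegral_peakWeight_pi_complexGaussian [Nonempty ι] :
    ∫⁻ v : ι → ℂ, ENNReal.ofReal (peakWeight v) ∂(Measure.pi fun _ => complexGaussian) =
      ENNReal.ofReal (∑ k ∈ Finset.range (Fintype.card ι), 1 / ((k : ℝ) + 1)) := by
  have hmeas := (continuous_peakWeight (ι := ι)).measurable
  rw [lintegral_eq_lintegral_meas_lt _ (.of_forall peakWeight_nonneg) hmeas.aemeasurable,
    ← lintegral_Ioi_one_sub_one_sub_exp_neg_pow]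
  refine setLIntegral_congr_fun measurableSet_Ioi fun t ht => ?_
  have h1 : Real.exp (-t) ≤ 1 := Real.exp_le_one_iff.2 (by simpa using le_of_lt ht)
  have h2 := sub_nonneg.2 h1
  have hset : {v : ι → ℂ | t < peakWeight v} =
      (Set.univ.pi fun _ => {z : ℂ | ‖z‖ ^ 2 ≤ t})ᶜ := by
    ext v
    simp [peakWeight, Finset.lt_sup'_iff]
  have hm : MeasurableSet (Set.univ.pi fun _ : ι => {z : ℂ | ‖z‖ ^ 2 ≤ t}) :=
    MeasurableSet.univ_pi fun _ => measurableSet_le (by fun_prop) measurable_const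
  simp only [hset]
  rw [prob_compl_eq_one_sub hm, Measure.pi_pi]
  simp only [complexGaussian_norm_sq_le (le_of_lt ht), Finset.prod_const, Finset.card_univ]
  rw [← ENNReal.ofReal_pow h2, ENNReal.ofReal_sub _ (by positivity), ENNReal.ofReal_one]

theorem lintegral_sum_norm_sq_pi_complexGaussian :
    ∫⁻ v : ι → ℂ, ENNReal.ofReal (∑ i, ‖v i‖ ^ 2) ∂(Measure.pi fun _ => complexGaussian) =
      Fintype.card ι := by
  simp only [ENNReal.ofReal_sum_of_nonneg fun i _ => sq_nonneg _]
  rw [lintegral_finsetSum _ fun i _ => by fun_prop]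
  have h : ∀ i : ι, ∫⁻ v : ι → ℂ, ENNReal.ofReal (‖v i‖ ^ 2)
      ∂(Measure.pi fun _ => complexGaussian) = 1 := fun i => by
    rw [← lintegral_norm_sq_complexGaussian]
    exact (measurePreserving_eval (fun _ : ι => complexGaussian) i).lintegral_comp
      (f := fun z => ENNReal.ofReal (‖z‖ ^ 2)) (by fun_prop)
  simp only [h, Finset.sum_const, Finset.card_univ, nsmul_eq_mul, mul_one]

theorem pi_complexGaussian_eq_withDensity :
    Measure.pi (fun _ : ι => complexGaussian) = volume.withDensity fun v =>
      ENNReal.ofReal (Real.exp (-∑ i, ‖v i‖ ^ 2) / Real.pi ^ Fintype.card ι) := by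
  have hprod : ∀ v : ι → ℂ, Real.exp (-∑ i, ‖v i‖ ^ 2) / Real.pi ^ Fintype.card ι =
      ∏ i, Real.exp (-‖v i‖ ^ 2) / Real.pi := fun v => by
    rw [Finset.prod_div_distrib, ← Real.exp_sum, Finset.sum_neg_distrib]
    simp
  simp only [hprod]
  refine Measure.pi_eq fun s hs => ?_
  rw [withDensity_apply _ (MeasurableSet.univ_pi hs), volume_pi, Measure.restrict_pi_pi,
    ← ofReal_integral_eq_lintegral_ofReal
      (Integrable.fintype_prod fun i => integrable_exp_neg_norm_sq_div_pi.integrableOn)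
      (.of_forall fun v => Finset.prod_nonneg fun i _ => by positivity),
    integral_fintype_prod_eq_prod (fun _ (z : ℂ) => Real.exp (-‖z‖ ^ 2) / Real.pi),
    ENNReal.ofReal_prod_of_nonneg fun i _ => integral_nonneg fun z => by positivity]
  refine Finset.prod_congr rfl fun i _ => ?_
  rw [complexGaussian, withDensity_apply _ (hs i),
    ofReal_integral_eq_lintegral_ofReal integrable_exp_neg_norm_sq_div_pi.integrableOn
      (.of_forall fun z => by positivity)]

variable [DecidableEq ι]

theorem sum_norm_sq_unitary_mulVec (U : unitaryGroup ι ℂ) (v : ι → ℂ) :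
    ∑ i, ‖((U : Matrix ι ι ℂ) *ᵥ v) i‖ ^ 2 = ∑ i, ‖v i‖ ^ 2 := by
  have h : ∀ w : ι → ℂ, ((∑ i, ‖w i‖ ^ 2 : ℝ) : ℂ) = star w ⬝ᵥ w := fun w => by
    simp [dotProduct, Complex.conj_mul']
  have hU : (U : Matrix ι ι ℂ)ᴴ * U = 1 := UnitaryGroup.star_mul_self U
  apply Complex.ofReal_injective
  rw [h, h, star_mulVec, ← dotProduct_mulVec, mulVec_mulVec, hU, one_mulVec]

theorem measurePreserving_unitary_mulVec (U : unitaryGroup ι ℂ) :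
    MeasurePreserving (fun v : ι → ℂ => (U : Matrix ι ι ℂ) *ᵥ v) := by
  have hdet : |LinearMap.det ((toLin' (U : Matrix ι ι ℂ)).restrictScalars ℝ)| = 1 := by
    have h1 : ‖det (U : Matrix ι ι ℂ)‖ = 1 :=
      CStarRing.norm_of_mem_unitary (det_of_mem_unitary U.2)
    rw [LinearMap.det_restrictScalars, LinearMap.det_toLin', Algebra.norm_complex_apply,
      Complex.normSq_eq_norm_sq, h1]
    simp
  have h := Measure.map_linearMap_addHaar_eq_smul_addHaar (volume : Measure (ι → ℂ))
    (f := (toLin' (U : Matrix ι ι ℂ)).restrictScalars ℝ) (by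
      intro h0
      simp [h0] at hdet)
  refine ⟨(Continuous.matrix_mulVec continuous_const continuous_id).measurable, ?_⟩
  rw [abs_inv, hdet, inv_one, ENNReal.ofReal_one, one_smul] at h
  exact h

theorem lintegral_unitary_mulVec_pi_complexGaussian (U : unitaryGroup ι ℂ)
    {f : (ι → ℂ) → ENNReal} (hf : Measurable f) :
    ∫⁻ v, f ((U : Matrix ι ι ℂ) *ᵥ v) ∂(Measure.pi fun _ => complexGaussian) =
      ∫⁻ v, f v ∂(Measure.pi fun _ => complexGaussian) := by
  have hU := measurePreserving_unitary_mulVec U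
  have hdens : Measurable fun v : ι → ℂ =>
      ENNReal.ofReal (Real.exp (-∑ i, ‖v i‖ ^ 2) / Real.pi ^ Fintype.card ι) := by
    fun_prop
  rw [pi_complexGaussian_eq_withDensity,
    lintegral_withDensity_eq_lintegral_mul _ hdens
      (g := fun v => f ((U : Matrix ι ι ℂ) *ᵥ v)) (hf.comp hU.measurable),
    lintegral_withDensity_eq_lintegral_mul _ hdens hf, ← hU.lintegral_comp (hdens.mul hf)]
  simp only [Pi.mul_apply, sum_norm_sq_unitary_mulVec]

theorem exists_unitary_mulVec_single (i₀ : ι) {v : ι → ℂ} (hv : ∑ i, ‖v i‖ ^ 2 = 1) :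
    ∃ V : unitaryGroup ι ℂ, (V : Matrix ι ι ℂ) *ᵥ Pi.single i₀ 1 = v := by
  have hnorm : ‖(WithLp.toLp 2 v : EuclideanSpace ℂ ι)‖ = 1 := by
    rw [EuclideanSpace.norm_eq, Real.sqrt_eq_one]
    exact hv
  obtain ⟨b, hb⟩ := Orthonormal.exists_orthonormalBasis_extension_of_card_eq (𝕜 := ℂ)
    (E := EuclideanSpace ℂ ι) (ι := ι) (by simp) (v := fun _ => WithLp.toLp 2 v) (s := {i₀})
    (by
      rw [orthonormal_iff_ite]
      rintro ⟨i, rfl⟩ ⟨j, rfl⟩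
      simp [inner_self_eq_norm_sq_to_K, hnorm])
  refine ⟨⟨(EuclideanSpace.basisFun ι ℂ).toBasis.toMatrix b.toBasis,
    (EuclideanSpace.basisFun ι ℂ).toMatrix_orthonormalBasis_mem_unitary b⟩, ?_⟩
  ext i
  simp [Module.Basis.toMatrix_apply, hb i₀ rfl]

theorem exists_unitary_mulVec_single_eq_smul (i₀ : ι) (v : ι → ℂ) :
    ∃ (c : ℂ) (V : unitaryGroup ι ℂ), ‖c‖ ^ 2 = ∑ i, ‖v i‖ ^ 2 ∧
      v = c • ((V : Matrix ι ι ℂ) *ᵥ Pi.single i₀ 1) := by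
  set r := ∑ i, ‖v i‖ ^ 2 with hr
  have hr0 : 0 ≤ r := by positivity
  have hc : ‖((√r : ℝ) : ℂ)‖ ^ 2 = r := by simp [Real.sq_sqrt hr0]
  by_cases h : r = 0
  · refine ⟨0, 1, by simp [h], ?_⟩
    ext i
    have := (Finset.sum_eq_zero_iff_of_nonneg fun i _ => sq_nonneg ‖v i‖).1 (hr ▸ h) i
    simpa using this
  · have hs : ((√r : ℝ) : ℂ) ≠ 0 := by
      intro h0
      rw [h0] at hc
      exact h (by simpa using hc.symm)
    obtain ⟨V, hV⟩ := exists_unitary_mulVec_single i₀ (v := ((√r : ℝ) : ℂ)⁻¹ • v) (by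
      simp only [Pi.smul_apply, norm_smul, mul_pow, norm_inv, inv_pow, hc]
      rw [← Finset.mul_sum, ← hr, inv_mul_cancel₀ h])
    exact ⟨_, V, hc, by rw [hV, smul_inv_smul₀ hs]⟩

instance : LocallyCompactSpace (unitaryGroup ι ℂ) :=
  have : LocallyCompactSpace (Matrix ι ι ℂ) := inferInstanceAs (LocallyCompactSpace (ι → ι → ℂ))
  (isClosed_unitary (R := Matrix ι ι ℂ)).locallyCompactSpace

instance : SecondCountableTopology (Matrix ι ι ℂ) :=
  inferInstanceAs (SecondCountableTopology (ι → ι → ℂ))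

variable [MeasurableSpace (unitaryGroup ι ℂ)] [BorelSpace (unitaryGroup ι ℂ)]

theorem measurePreserving_mul_right_unitaryGroup (μ : Measure (unitaryGroup ι ℂ))
    [μ.IsHaarMeasure] [IsProbabilityMeasure μ] (V : unitaryGroup ι ℂ) :
    MeasurePreserving (· * V) μ μ := by
  have hm : Measurable (· * V : unitaryGroup ι ℂ → _) := (continuous_mul_const V).measurable
  have : IsProbabilityMeasure (μ.map (· * V)) := Measure.isProbabilityMeasure_map hm.aemeasurable
  exact ⟨hm, Measure.isHaarMeasure_eq_of_isProbabilityMeasure _ _⟩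

theorem lintegral_peakWeight_unitary_mulVec [Nonempty ι] (μ : Measure (unitaryGroup ι ℂ))
    [μ.IsHaarMeasure] [IsProbabilityMeasure μ] (i₀ : ι) (v : ι → ℂ) :
    ∫⁻ U, ENNReal.ofReal (peakWeight ((U : Matrix ι ι ℂ) *ᵥ v)) ∂μ =
      ENNReal.ofReal (∑ i, ‖v i‖ ^ 2) *
        ∫⁻ U, ENNReal.ofReal (peakWeight ((U : Matrix ι ι ℂ) *ᵥ Pi.single i₀ 1)) ∂μ := by
  have hmeas : ∀ w : ι → ℂ, Measurable fun U : unitaryGroup ι ℂ =>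
      ENNReal.ofReal (peakWeight ((U : Matrix ι ι ℂ) *ᵥ w)) := fun w =>
    (ENNReal.continuous_ofReal.comp (continuous_peakWeight.comp
      (Continuous.matrix_mulVec continuous_subtype_val continuous_const))).measurable
  obtain ⟨c, V, hc, hv⟩ := exists_unitary_mulVec_single_eq_smul i₀ v
  rw [← hc, ← (measurePreserving_mul_right_unitaryGroup μ V).lintegral_comp
      (f := fun U => ENNReal.ofReal (peakWeight ((U : Matrix ι ι ℂ) *ᵥ Pi.single i₀ 1)))
      (hmeas _),
    ← lintegral_const_mul' _ _ ENNReal.ofReal_ne_top]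
  refine lintegral_congr fun U => ?_
  rw [hv, mulVec_smul, peakWeight_smul, mulVec_mulVec, ENNReal.ofReal_mul (by positivity)]
  rfl

theorem card_mul_lintegral_peakWeight_haar [Nonempty ι] (μ : Measure (unitaryGroup ι ℂ))
    [μ.IsHaarMeasure] [IsProbabilityMeasure μ] (i₀ : ι) :
    (Fintype.card ι : ENNReal) *
        ∫⁻ U, ENNReal.ofReal (peakWeight ((U : Matrix ι ι ℂ) *ᵥ Pi.single i₀ 1)) ∂μ =
      ENNReal.ofReal (∑ k ∈ Finset.range (Fintype.card ι), 1 / ((k : ℝ) + 1)) := by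
  have hcont : Continuous fun p : (ι → ℂ) × unitaryGroup ι ℂ =>
      ENNReal.ofReal (peakWeight ((p.2 : Matrix ι ι ℂ) *ᵥ p.1)) :=
    ENNReal.continuous_ofReal.comp (continuous_peakWeight.comp
      (Continuous.matrix_mulVec (continuous_subtype_val.comp continuous_snd) continuous_fst))
  rw [← lintegral_sum_norm_sq_pi_complexGaussian, ← lintegral_mul_const _ (by fun_prop)]
  simp only [← lintegral_peakWeight_unitary_mulVec μ i₀]
  rw [lintegral_lintegral_swap hcont.measurable.aemeasurable]
  simp only [lintegral_unitary_mulVec_pi_complexGaussian _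
    (continuous_peakWeight (ι := ι)).measurable.ennreal_ofReal,
    lintegral_peakWeight_pi_complexGaussian]
  simp

end

/-- **Expected peak weight of a Haar-random state.**
Let `μ` be the Haar probability measure on the unitary group `U(d)`.  The expectation,
over `U ~ μ`, of the largest squared amplitude of the Haar-random unit vector `U e₀`
equals `(1/d) ∑_{k=1}^{d} 1/k`.  (For `d = 4` this is `25/48`.) -/
theorem expected_max_amplitude_haar_random_state
    (d : ℕ) (hd : 1 ≤ d)
    [MeasurableSpace (Matrix.unitaryGroup (Fin d) ℂ)]
    [BorelSpace (Matrix.unitaryGroup (Fin d) ℂ)]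
    (μ : Measure (Matrix.unitaryGroup (Fin d) ℂ))
    [μ.IsHaarMeasure] [IsProbabilityMeasure μ]
    (e₀ : Fin d → ℂ) (he₀ : e₀ = Pi.single (⟨0, hd⟩ : Fin d) 1) :
    ∫ U, (Finset.univ.sup' ⟨⟨0, hd⟩, Finset.mem_univ _⟩
        fun i : Fin d => ‖((U : Matrix (Fin d) (Fin d) ℂ) *ᵥ e₀) i‖ ^ 2) ∂μ =
      (1 / d : ℝ) * ∑ k ∈ Finset.Icc 1 d, (1 / k : ℝ) := by
  subst he₀
  have : Nonempty (Fin d) := ⟨⟨0, hd⟩⟩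
  change ∫ U, peakWeight ((U : Matrix (Fin d) (Fin d) ℂ) *ᵥ Pi.single (⟨0, hd⟩ : Fin d) 1) ∂μ = _
  have hcont : Continuous fun U : unitaryGroup (Fin d) ℂ =>
      peakWeight ((U : Matrix (Fin d) (Fin d) ℂ) *ᵥ Pi.single (⟨0, hd⟩ : Fin d) 1) :=
    continuous_peakWeight.comp (Continuous.matrix_mulVec continuous_subtype_val continuous_const)
  rw [integral_eq_lintegral_of_nonneg_ae (.of_forall fun U => peakWeight_nonneg _)
    hcont.measurable.aestronglyMeasurable]
  have h := congrArg ENNReal.toReal (card_mul_lintegral_peakWeight_haar μ (⟨0, hd⟩ : Fin d))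
  rw [ENNReal.toReal_mul, ENNReal.toReal_natCast, ENNReal.toReal_ofReal (by positivity),
    Fintype.card_fin] at h
  have hd0 : (d : ℝ) ≠ 0 := by positivity
  have hsum : ∑ k ∈ Finset.Icc 1 d, (1 / k : ℝ) = ∑ k ∈ Finset.range d, 1 / ((k : ℝ) + 1) := by
    rw [Finset.range_eq_Ico, ← Finset.Ico_add_one_right_eq_Icc,
      ← Finset.sum_Ico_add' (fun k : ℕ => 1 / (k : ℝ)) 0 d 1]
    simp
  rw [hsum, ← h]
  field_simp
end

section
/- Let U be a Haar-random element of the unitary group U(4) and let ψ = U e₀ ∈ ℂ⁴ be the corresponding Haar-random two-qubit unit vector. Define the 2×2 complex matrix M by M_{i,j} = ψ_{2i+j} for i, j ∈ {0,1} (the reshaping of ψ into a matrix, so that M M† is the reduced density matrix of the first qubit). Then the expected largest eigenvalue of the positive semidefinite matrix M M† (equivalently, the expected largest squared Schmidt coefficient of the random two-qubit state) equals 7/8. -/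
open Matrix MeasureTheory

/-- The `2×2` reshaping `M` of a two-qubit vector `ψ ∈ ℂ⁴`, with `M i j = ψ (2i + j)`;
then `M Mᴴ` is the reduced density matrix of the first qubit. -/
def reshape2 (ψ : Fin 4 → ℂ) : Matrix (Fin 2) (Fin 2) ℂ :=
  Matrix.of fun i j : Fin 2 =>
    ψ ⟨2 * i.val + j.val, by have := i.isLt; have := j.isLt; omega⟩

/-- The largest eigenvalue of a Hermitian `2×2` complex matrix. -/
noncomputable def lambdaMax (A : Matrix (Fin 2) (Fin 2) ℂ) (hA : A.IsHermitian) : ℝ :=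
  Finset.univ.sup' Finset.univ_nonempty hA.eigenvalues

open Real Set Module

theorem lambdaMax_eq (A : Matrix (Fin 2) (Fin 2) ℂ) (hA : A.IsHermitian) :
    lambdaMax A hA = (A.trace.re + √(A.trace.re ^ 2 - 4 * A.det.re)) / 2 := by
  have ht : A.trace.re = hA.eigenvalues 0 + hA.eigenvalues 1 := by
    simp [hA.trace_eq_sum_eigenvalues]
  have hd : A.det.re = hA.eigenvalues 0 * hA.eigenvalues 1 := by
    simp [hA.det_eq_prod_eigenvalues]
  have hmax : lambdaMax A hA = max (hA.eigenvalues 0) (hA.eigenvalues 1) := by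
    refine le_antisymm (Finset.sup'_le _ _ fun i _ => ?_) (max_le ?_ ?_)
    · fin_cases i <;> simp
    all_goals exact Finset.le_sup' _ (Finset.mem_univ _)
  have hsq : (hA.eigenvalues 0 + hA.eigenvalues 1) ^ 2 - 4 * (hA.eigenvalues 0 * hA.eigenvalues 1) =
      (hA.eigenvalues 0 - hA.eigenvalues 1) ^ 2 := by ring
  rw [hmax, ht, hd, hsq, Real.sqrt_sq_eq_abs]
  rcases le_total (hA.eigenvalues 0) (hA.eigenvalues 1) with h | h
  · rw [max_eq_right h, abs_of_nonpos (by linarith)]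
    ring
  · rw [max_eq_left h, abs_of_nonneg (by linarith)]
    ring

/-- The difference of the squared Schmidt coefficients of a two-qubit vector,
as a homogeneous function of degree two. -/
noncomputable def schmidtGap (ψ : EuclideanSpace ℂ (Fin 4)) : ℝ :=
  √((‖ψ‖ ^ 2) ^ 2 - 4 * ‖ψ 0 * ψ 3 - ψ 1 * ψ 2‖ ^ 2)

theorem lambdaMax_reshape2 (ψ : EuclideanSpace ℂ (Fin 4)) :
    lambdaMax (reshape2 ψ * (reshape2 ψ)ᴴ) (Matrix.isHermitian_mul_conjTranspose_self _) =
      (‖ψ‖ ^ 2 + schmidtGap ψ) / 2 := by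
  have htr : (reshape2 ψ * (reshape2 ψ)ᴴ).trace.re = ‖ψ‖ ^ 2 := by
    simp [EuclideanSpace.norm_sq_eq, Fin.sum_univ_four, Matrix.trace, Matrix.mul_apply, reshape2,
      Fin.sum_univ_two, Complex.sq_norm, Complex.normSq_apply]
    ring
  have hdet : (reshape2 ψ * (reshape2 ψ)ᴴ).det.re = ‖ψ 0 * ψ 3 - ψ 1 * ψ 2‖ ^ 2 := by
    rw [Matrix.det_mul, Matrix.det_conjTranspose, Complex.star_def, Complex.mul_conj,
      Complex.normSq_eq_norm_sq, Complex.ofReal_re, Matrix.det_fin_two, mul_comm (ψ 1)]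
    simp [reshape2, mul_comm]
  rw [lambdaMax_eq, htr, hdet, schmidtGap]

theorem schmidtGap_nonneg (ψ : EuclideanSpace ℂ (Fin 4)) : 0 ≤ schmidtGap ψ :=
  Real.sqrt_nonneg _

theorem schmidtGap_le (ψ : EuclideanSpace ℂ (Fin 4)) : schmidtGap ψ ≤ ‖ψ‖ ^ 2 := by
  refine Real.sqrt_le_iff.2 ⟨by positivity, ?_⟩
  have : (0 : ℝ) ≤ 4 * ‖ψ 0 * ψ 3 - ψ 1 * ψ 2‖ ^ 2 := by positivity
  linarith

theorem continuous_schmidtGap : Continuous schmidtGap := by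
  unfold schmidtGap
  fun_prop

theorem schmidtGap_smul (r : ℝ) (ψ : EuclideanSpace ℂ (Fin 4)) :
    schmidtGap ((r : ℂ) • ψ) = r ^ 2 * schmidtGap ψ := by
  have h : (r : ℂ) * ψ 0 * (r * ψ 3) - r * ψ 1 * (r * ψ 2) =
      (r : ℂ) ^ 2 * (ψ 0 * ψ 3 - ψ 1 * ψ 2) := by ring
  rw [schmidtGap, schmidtGap, ← Real.sqrt_sq (sq_nonneg r), ← Real.sqrt_mul (by positivity)]
  simp only [PiLp.smul_apply, smul_eq_mul, h, norm_smul, norm_mul, norm_pow, Complex.norm_real,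
    Real.norm_eq_abs, mul_pow, sq_abs]
  congr 1
  ring

/-- The action of the unitary group on Euclidean space by isometries. -/
noncomputable def Matrix.unitaryGroup.toIsometry (n : Type*) [Fintype n] [DecidableEq n] :
    unitaryGroup n ℂ →* (EuclideanSpace ℂ n ≃ₗᵢ[ℂ] EuclideanSpace ℂ n) :=
  Unitary.linearIsometryEquiv.toMonoidHom.comp
    (Unitary.map (StarMonoidHom.mk (toEuclideanCLM (n := n) (𝕜 := ℂ))
      (map_star (toEuclideanCLM (n := n) (𝕜 := ℂ))))).toMonoidHom

open Matrix.unitaryGroup (toIsometry)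

theorem Matrix.unitaryGroup.toIsometry_apply {n : Type*} [Fintype n] [DecidableEq n]
    (U : unitaryGroup n ℂ) (z : EuclideanSpace ℂ n) :
    toIsometry n U z = WithLp.toLp 2 ((U : Matrix n n ℂ) *ᵥ z) :=
  rfl

instance (n : Type*) [Fintype n] [DecidableEq n] : CompactSpace (unitaryGroup n ℂ) := by
  refine isCompact_iff_compactSpace.1 ?_
  have hsub : ((unitaryGroup n ℂ : Submonoid (Matrix n n ℂ)) : Set (Matrix n n ℂ)) ⊆
      Set.pi univ fun _ => Set.pi univ fun _ => Metric.closedBall 0 1 := by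
    intro U hU i _ j _
    simpa using entry_norm_bound_of_unitary hU i j
  refine IsCompact.of_isClosed_subset (isCompact_univ_pi fun _ => isCompact_univ_pi fun _ =>
    isCompact_closedBall _ _) ?_ hsub
  exact isClosed_unitary

theorem exists_toIsometry_single_eq (z : EuclideanSpace ℂ (Fin 4)) :
    ∃ W : unitaryGroup (Fin 4) ℂ,
      z = (‖z‖ : ℂ) • toIsometry (Fin 4) W (EuclideanSpace.single 0 1) := by
  rcases eq_or_ne z 0 with rfl | hz
  · exact ⟨1, by simp⟩
  have hz' : (‖z‖ : ℂ) ≠ 0 := by simpa using hz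
  obtain ⟨b, hb⟩ := Orthonormal.exists_orthonormalBasis_extension_of_card_eq (𝕜 := ℂ)
    (ι := Fin 4) (v := fun _ => (‖z‖ : ℂ)⁻¹ • z) (s := {0}) (by simp)
    ⟨fun i => by simp [norm_smul, hz], fun i j hij => (hij (Subsingleton.elim _ _)).elim⟩
  refine ⟨⟨(EuclideanSpace.basisFun (Fin 4) ℂ).toBasis.toMatrix b,
    OrthonormalBasis.toMatrix_orthonormalBasis_mem_unitary _ _⟩, ?_⟩
  have h0 := hb 0 rfl
  ext i
  simp [unitaryGroup.toIsometry_apply, Basis.toMatrix_apply, h0, hz]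

theorem continuous_toIsometry_apply :
    Continuous fun p : unitaryGroup (Fin 4) ℂ × EuclideanSpace ℂ (Fin 4) =>
      toIsometry (Fin 4) p.1 p.2 := by
  simp only [unitaryGroup.toIsometry_apply]
  fun_prop

section GaussianMoments

variable (E : Type*) [NormedAddCommGroup E] [InnerProductSpace ℝ E] [FiniteDimensional ℝ E]
  [MeasurableSpace E] [BorelSpace E]

theorem integrable_norm_pow_mul_exp_neg_norm_sq [Nontrivial E] (k : ℕ) :
    Integrable fun x : E => ‖x‖ ^ k * rexp (-‖x‖ ^ 2) := by
  rw [integrable_fun_norm_addHaar volume (f := fun r => r ^ k * rexp (-r ^ 2))]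
  have h := integrableOn_rpow_mul_exp_neg_mul_sq (b := 1) one_pos
    (s := ((finrank ℝ E - 1 + k : ℕ) : ℝ))
    (by linarith [Nat.cast_nonneg (α := ℝ) (finrank ℝ E - 1 + k)])
  refine h.congr_fun (fun r _ => ?_) measurableSet_Ioi
  simp only [rpow_natCast, neg_mul, one_mul, pow_add, smul_eq_mul, mul_assoc]

theorem integral_norm_pow_mul_exp_neg_norm_sq [Nontrivial E] (k : ℕ) :
    ∫ x : E, ‖x‖ ^ k * rexp (-‖x‖ ^ 2) =
      π ^ (finrank ℝ E / 2 : ℝ) * (Gamma ((finrank ℝ E + k) / 2) / Gamma (finrank ℝ E / 2)) := by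
  have hpos : (0 : ℝ) < finrank ℝ E := by exact_mod_cast finrank_pos
  have radial (k : ℕ) : ∫ x : E, ‖x‖ ^ k * rexp (-‖x‖ ^ 2) =
      finrank ℝ E * volume.real (Metric.ball (0 : E) 1) / 2 * Gamma ((finrank ℝ E + k) / 2) := by
    have h : ∫ r in Ioi (0 : ℝ), r ^ (finrank ℝ E - 1) • (r ^ k * rexp (-r ^ 2)) =
        1 / 2 * Gamma ((finrank ℝ E + k) / 2) := by
      have h2 := integral_rpow_mul_exp_neg_rpow (p := 2) (q := ((finrank ℝ E - 1 + k : ℕ) : ℝ))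
        two_pos (by linarith [Nat.cast_nonneg (α := ℝ) (finrank ℝ E - 1 + k)])
      have h3 : ((finrank ℝ E - 1 + k : ℕ) : ℝ) + 1 = finrank ℝ E + k := by
        rw [Nat.cast_add, Nat.cast_sub (Nat.one_le_iff_ne_zero.2 finrank_pos.ne')]
        push_cast
        ring
      rw [h3] at h2
      rw [← h2]
      refine setIntegral_congr_fun measurableSet_Ioi fun r _ => ?_
      simp only [rpow_natCast, rpow_two, pow_add, smul_eq_mul, mul_assoc]
    rw [integral_fun_norm_addHaar volume fun r => r ^ k * rexp (-r ^ 2), h, nsmul_eq_mul,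
      smul_eq_mul]
    ring
  have h0 := radial 0
  have hg := GaussianFourier.integral_rexp_neg_mul_sq_norm (V := E) one_pos
  simp only [pow_zero, one_mul, Nat.cast_zero, add_zero] at h0
  simp only [neg_mul, one_mul, div_one] at hg
  rw [radial, ← hg, h0]
  field_simp [(Gamma_pos_of_pos (half_pos hpos)).ne']

end GaussianMoments

theorem integral_toIsometry_single_mul [MeasurableSpace (unitaryGroup (Fin 4) ℂ)]
    [BorelSpace (unitaryGroup (Fin 4) ℂ)] (μ : Measure (unitaryGroup (Fin 4) ℂ))
    [μ.IsHaarMeasure] [IsProbabilityMeasure μ] {f : EuclideanSpace ℂ (Fin 4) → ℝ}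
    (hf : Continuous f) (hom : ∀ (r : ℝ) z, f ((r : ℂ) • z) = r ^ 2 * f z)
    (bound : ∀ z, |f z| ≤ ‖z‖ ^ 2) :
    (∫ U, f (toIsometry (Fin 4) U (EuclideanSpace.single 0 1)) ∂μ) *
        ∫ z : EuclideanSpace ℂ (Fin 4), ‖z‖ ^ 2 * rexp (-‖z‖ ^ 2) =
      ∫ z : EuclideanSpace ℂ (Fin 4), f z * rexp (-‖z‖ ^ 2) := by
  have : SecondCountableTopology (Matrix (Fin 4) (Fin 4) ℂ) :=
    inferInstanceAs (SecondCountableTopology (Fin 4 → Fin 4 → ℂ))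
  have : SecondCountableTopology (unitaryGroup (Fin 4) ℂ) :=
    TopologicalSpace.Subtype.secondCountableTopology _
  have : μ.IsMulRightInvariant := ⟨fun g =>
    have : IsProbabilityMeasure (μ.map (· * g)) :=
      Measure.isProbabilityMeasure_map (measurable_mul_const g).aemeasurable
    Measure.isHaarMeasure_eq_of_isProbabilityMeasure _ _⟩
  have sphere (z : EuclideanSpace ℂ (Fin 4)) : ∫ U, f (toIsometry (Fin 4) U z) ∂μ =
      ‖z‖ ^ 2 * ∫ U, f (toIsometry (Fin 4) U (EuclideanSpace.single 0 1)) ∂μ := by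
    obtain ⟨W, hW⟩ := exists_toIsometry_single_eq z
    rw [← integral_const_mul, ← integral_mul_right_eq_self
      (fun U => ‖z‖ ^ 2 * f (toIsometry (Fin 4) U (EuclideanSpace.single 0 1))) W]
    refine integral_congr_ae (.of_forall fun U => ?_)
    simp only
    rw [← hom, map_mul, LinearIsometryEquiv.coe_mul, Function.comp_apply, ← map_smul, ← hW]
  have invariant (U : unitaryGroup (Fin 4) ℂ) :
      ∫ z, f (toIsometry (Fin 4) U z) * rexp (-‖z‖ ^ 2) = ∫ z, f z * rexp (-‖z‖ ^ 2) := by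
    let e : EuclideanSpace ℂ (Fin 4) ≃ₗᵢ[ℝ] EuclideanSpace ℂ (Fin 4) :=
      ⟨(toIsometry (Fin 4) U).toLinearEquiv.restrictScalars ℝ, (toIsometry (Fin 4) U).norm_map⟩
    rw [← e.measurePreserving.integral_comp e.toHomeomorph.measurableEmbedding
      fun z => f z * rexp (-‖z‖ ^ 2)]
    simp only [e.norm_map]
    rfl
  have integrable : Integrable (Function.uncurry fun (U : unitaryGroup (Fin 4) ℂ)
      (z : EuclideanSpace ℂ (Fin 4)) => f (toIsometry (Fin 4) U z) * rexp (-‖z‖ ^ 2))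
      (μ.prod volume) := by
    refine ((integrable_norm_pow_mul_exp_neg_norm_sq
      (EuclideanSpace ℂ (Fin 4)) 2).comp_snd μ).mono' ?_ (.of_forall fun p => ?_)
    · exact ((hf.comp continuous_toIsometry_apply).mul (by fun_prop)).aestronglyMeasurable
    · simp only [Function.uncurry, norm_mul, Real.norm_eq_abs, abs_exp]
      gcongr
      simpa using bound (toIsometry (Fin 4) p.1 p.2)
  calc _ = ∫ z, (∫ U, f (toIsometry (Fin 4) U z) * rexp (-‖z‖ ^ 2) ∂μ) := by
        rw [← integral_const_mul]
        refine integral_congr_ae (.of_forall fun z => ?_)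
        simp only
        rw [integral_mul_const, sphere z]
        ring
    _ = ∫ U, (∫ z, f (toIsometry (Fin 4) U z) * rexp (-‖z‖ ^ 2)) ∂μ :=
        (integral_integral_swap integrable).symm
    _ = _ := by simp [invariant]

theorem exists_linearIsometryEquiv_apply_eq (x : EuclideanSpace ℝ (Fin 4)) :
    ∃ L : EuclideanSpace ℝ (Fin 4) ≃ₗᵢ[ℝ] WithLp 2 (ℝ × EuclideanSpace ℝ (Fin 3)),
      L x = WithLp.toLp 2 (‖x‖, 0) := by
  have hrank : finrank ℝ (EuclideanSpace ℝ (Fin 4)) =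
      finrank ℝ (WithLp 2 (ℝ × EuclideanSpace ℝ (Fin 3))) := by
    rw [(WithLp.linearEquiv 2 ℝ (ℝ × EuclideanSpace ℝ (Fin 3))).finrank_eq]
    simp
  let L := (stdOrthonormalBasis ℝ (EuclideanSpace ℝ (Fin 4))).equiv
    (stdOrthonormalBasis ℝ (WithLp 2 (ℝ × EuclideanSpace ℝ (Fin 3)))) (finCongr hrank)
  refine ⟨L.trans (Submodule.reflection (ℝ ∙ (L x - WithLp.toLp 2 (‖x‖, 0)))ᗮ), ?_⟩
  refine Submodule.reflection_sub ?_
  rw [L.norm_map, ← sq_eq_sq₀ (norm_nonneg _) (norm_nonneg _), WithLp.prod_norm_sq_eq_of_L2]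
  simp

theorem integral_sqrt_gram_mul_exp_neg_norm_sq (x : EuclideanSpace ℝ (Fin 4)) :
    ∫ y, √(‖x‖ ^ 2 * ‖y‖ ^ 2 - inner ℝ x y ^ 2) * rexp (-‖y‖ ^ 2) =
      ‖x‖ * ((∫ s : ℝ, rexp (-s ^ 2)) *
        ∫ y : EuclideanSpace ℝ (Fin 3), ‖y‖ * rexp (-‖y‖ ^ 2)) := by
  obtain ⟨L, hL⟩ := exists_linearIsometryEquiv_apply_eq x
  let g : ℝ × EuclideanSpace ℝ (Fin 3) → ℝ := fun p =>
    ‖x‖ * (rexp (-p.1 ^ 2) * (‖p.2‖ * rexp (-‖p.2‖ ^ 2)))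
  have hg (y : EuclideanSpace ℝ (Fin 4)) :
      √(‖x‖ ^ 2 * ‖y‖ ^ 2 - inner ℝ x y ^ 2) * rexp (-‖y‖ ^ 2) = g (WithLp.ofLp (L y)) := by
    have hy : ‖y‖ ^ 2 = (L y).fst ^ 2 + ‖(L y).snd‖ ^ 2 := by
      rw [← L.norm_map, WithLp.prod_norm_sq_eq_of_L2]
      simp
    have hxy : inner ℝ x y = ‖x‖ * (L y).fst := by
      rw [← L.inner_map_map, hL, WithLp.prod_inner_apply]
      simp [mul_comm]
    have hsq : ‖x‖ ^ 2 * ((L y).fst ^ 2 + ‖(L y).snd‖ ^ 2) - (‖x‖ * (L y).fst) ^ 2 =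
        (‖x‖ * ‖(L y).snd‖) ^ 2 := by ring
    rw [hxy, hy, hsq, Real.sqrt_sq (by positivity), neg_add, Real.exp_add]
    simp only [g, WithLp.ofLp_fst, WithLp.ofLp_snd]
    ring
  simp only [hg]
  rw [L.measurePreserving.integral_comp L.toHomeomorph.measurableEmbedding
    fun p => g (WithLp.ofLp p),
    (WithLp.volume_preserving_ofLp ℝ (EuclideanSpace ℝ (Fin 3))).integral_comp
      (MeasurableEquiv.toLp 2 (ℝ × EuclideanSpace ℝ (Fin 3))).symm.measurableEmbedding g]
  simp only [g]
  rw [integral_const_mul, Measure.volume_eq_prod,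
    integral_prod_mul (fun s : ℝ => rexp (-s ^ 2))
      fun y : EuclideanSpace ℝ (Fin 3) => ‖y‖ * rexp (-‖y‖ ^ 2)]

/-- The real-linear isometry given by the magic basis of two qubits; it turns the determinant
of the reshaping into half the complex quadratic form `∑ k, (x k + i y k) ^ 2`. -/
noncomputable def magicIsometry :
    WithLp 2 (EuclideanSpace ℝ (Fin 4) × EuclideanSpace ℝ (Fin 4)) →ₗᵢ[ℝ]
      EuclideanSpace ℂ (Fin 4) where
  toFun p := (√2)⁻¹ • !₂[
    (⟨p.fst 0 - p.snd 1, p.snd 0 + p.fst 1⟩ : ℂ),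
    (⟨p.fst 2 - p.snd 3, p.snd 2 + p.fst 3⟩ : ℂ),
    (⟨-(p.fst 2 + p.snd 3), -(p.snd 2 - p.fst 3)⟩ : ℂ),
    (⟨p.fst 0 + p.snd 1, p.snd 0 - p.fst 1⟩ : ℂ)]
  map_add' p q := by
    rw [← smul_add]
    congr 1
    ext i
    fin_cases i <;> apply Complex.ext <;> simp <;> ring
  map_smul' r p := by
    rw [RingHom.id_apply, smul_comm]
    congr 1
    ext i
    fin_cases i <;> apply Complex.ext <;> simp <;> ring
  norm_map' p := by
    rw [← sq_eq_sq₀ (norm_nonneg _) (norm_nonneg _), WithLp.prod_norm_sq_eq_of_L2]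
    simp only [LinearMap.coe_mk, AddHom.coe_mk, norm_smul, mul_pow, EuclideanSpace.norm_sq_eq,
      Fin.sum_univ_four, Complex.sq_norm, Complex.normSq_apply]
    simp
    ring

theorem schmidtGap_magicIsometry
    (p : WithLp 2 (EuclideanSpace ℝ (Fin 4) × EuclideanSpace ℝ (Fin 4))) :
    schmidtGap (magicIsometry p) =
      2 * √(‖p.fst‖ ^ 2 * ‖p.snd‖ ^ 2 - inner ℝ p.fst p.snd ^ 2) := by
  have hdet : ‖magicIsometry p 0 * magicIsometry p 3 - magicIsometry p 1 * magicIsometry p 2‖ ^ 2 =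
      ((‖p.fst‖ ^ 2 - ‖p.snd‖ ^ 2) ^ 2 + 4 * inner ℝ p.fst p.snd ^ 2) / 4 := by
    have h2 : (√2)⁻¹ * (√2)⁻¹ = (1 / 2 : ℝ) := by
      rw [← mul_inv, Real.mul_self_sqrt two_pos.le, one_div]
    have h : magicIsometry p 0 * magicIsometry p 3 - magicIsometry p 1 * magicIsometry p 2 =
        ⟨(‖p.fst‖ ^ 2 - ‖p.snd‖ ^ 2) / 2, inner ℝ p.fst p.snd⟩ := by
      simp only [EuclideanSpace.norm_sq_eq, PiLp.inner_apply, Fin.sum_univ_four]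
      apply Complex.ext <;> simp [magicIsometry]
      all_goals grind
    rw [h, Complex.sq_norm, Complex.normSq_mk]
    ring
  rw [schmidtGap, hdet, magicIsometry.norm_map, WithLp.prod_norm_sq_eq_of_L2]
  trans √(2 ^ 2 * (‖p.fst‖ ^ 2 * ‖p.snd‖ ^ 2 - inner ℝ p.fst p.snd ^ 2))
  · congr 1
    ring
  · rw [Real.sqrt_mul (by norm_num), Real.sqrt_sq two_pos.le]

theorem integral_schmidtGap_mul_exp_neg_norm_sq :
    ∫ z, schmidtGap z * rexp (-‖z‖ ^ 2) =
      2 * ((∫ x : EuclideanSpace ℝ (Fin 4), ‖x‖ * rexp (-‖x‖ ^ 2)) *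
        ((∫ s : ℝ, rexp (-s ^ 2)) *
          ∫ y : EuclideanSpace ℝ (Fin 3), ‖y‖ * rexp (-‖y‖ ^ 2))) := by
  have hrank : finrank ℝ (WithLp 2 (EuclideanSpace ℝ (Fin 4) × EuclideanSpace ℝ (Fin 4))) =
      finrank ℝ (EuclideanSpace ℂ (Fin 4)) := by
    rw [(WithLp.linearEquiv 2 ℝ (EuclideanSpace ℝ (Fin 4) × EuclideanSpace ℝ (Fin 4))).finrank_eq,
      ← finrank_mul_finrank ℝ ℂ (EuclideanSpace ℂ (Fin 4))]
    simp
  let T := magicIsometry.toLinearIsometryEquiv hrank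
  let e := MeasurableEquiv.toLp 2 (EuclideanSpace ℝ (Fin 4) × EuclideanSpace ℝ (Fin 4))
  let f : EuclideanSpace ℂ (Fin 4) → ℝ := fun z => schmidtGap z * rexp (-‖z‖ ^ 2)
  have mp : MeasurePreserving fun p => T (e p) :=
    T.measurePreserving.comp (WithLp.volume_preserving_toLp _ _)
  have emb : MeasurableEmbedding fun p => T (e p) :=
    T.toHomeomorph.measurableEmbedding.comp e.measurableEmbedding
  have hf (x y : EuclideanSpace ℝ (Fin 4)) : f (T (e (x, y))) =
      2 * rexp (-‖x‖ ^ 2) *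
        (√(‖x‖ ^ 2 * ‖y‖ ^ 2 - inner ℝ x y ^ 2) * rexp (-‖y‖ ^ 2)) := by
    have h1 : schmidtGap (T (e (x, y))) = _ := schmidtGap_magicIsometry (WithLp.toLp 2 (x, y))
    have h2 : ‖T (e (x, y))‖ ^ 2 = ‖x‖ ^ 2 + ‖y‖ ^ 2 := by
      rw [T.norm_map, WithLp.prod_norm_sq_eq_of_L2]
      rfl
    simp only [f, h1, h2, neg_add, Real.exp_add]
    simp only [WithLp.toLp_fst, WithLp.toLp_snd]
    ring
  have integrable : Integrable f := by
    refine (integrable_norm_pow_mul_exp_neg_norm_sq (EuclideanSpace ℂ (Fin 4)) 2).mono'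
      (continuous_schmidtGap.mul (by fun_prop)).aestronglyMeasurable (.of_forall fun z => ?_)
    simp only [f, norm_mul, Real.norm_eq_abs, abs_exp, abs_of_nonneg (schmidtGap_nonneg z)]
    gcongr
    exact schmidtGap_le z
  calc ∫ z, f z = ∫ p, f (T (e p)) := (mp.integral_comp emb f).symm
    _ = ∫ x, ∫ y, f (T (e (x, y))) :=
      integral_prod _ ((mp.integrable_comp_emb emb).2 integrable)
    _ = _ := by
      simp only [hf, integral_const_mul, integral_sqrt_gram_mul_exp_neg_norm_sq]
      generalize ((∫ s : ℝ, rexp (-s ^ 2)) *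
        ∫ y : EuclideanSpace ℝ (Fin 3), ‖y‖ * rexp (-‖y‖ ^ 2)) = c
      rw [← integral_mul_const, ← integral_const_mul]
      refine integral_congr_ae (.of_forall fun x => ?_)
      ring

theorem integral_schmidtGap_toIsometry_single [MeasurableSpace (unitaryGroup (Fin 4) ℂ)]
    [BorelSpace (unitaryGroup (Fin 4) ℂ)] (μ : Measure (unitaryGroup (Fin 4) ℂ))
    [μ.IsHaarMeasure] [IsProbabilityMeasure μ] :
    ∫ U, schmidtGap (toIsometry (Fin 4) U (EuclideanSpace.single 0 1)) ∂μ = 3 / 4 := by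
  have h := integral_toIsometry_single_mul μ continuous_schmidtGap schmidtGap_smul
    fun z => (abs_of_nonneg (schmidtGap_nonneg z)).trans_le (schmidtGap_le z)
  have hrank : finrank ℝ (EuclideanSpace ℂ (Fin 4)) = 8 := by
    rw [← finrank_mul_finrank ℝ ℂ (EuclideanSpace ℂ (Fin 4))]
    simp
  have h8 := integral_norm_pow_mul_exp_neg_norm_sq (EuclideanSpace ℂ (Fin 4)) 2
  have h4 := integral_norm_pow_mul_exp_neg_norm_sq (EuclideanSpace ℝ (Fin 4)) 1
  have h3 := integral_norm_pow_mul_exp_neg_norm_sq (EuclideanSpace ℝ (Fin 3)) 1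
  have h1 : ∫ s : ℝ, rexp (-s ^ 2) = √π := by simpa using integral_gaussian 1
  have g5 : Gamma 5 = 4 * Gamma 4 := by
    rw [← Gamma_add_one (by norm_num)]
    norm_num
  have g52 : Gamma (5 / 2) = 3 / 2 * Gamma (3 / 2) := by
    rw [← Gamma_add_one (by norm_num)]
    norm_num
  have p32 : π ^ (3 / 2 : ℝ) = π * √π := by
    rw [Real.sqrt_eq_rpow, ← rpow_one_add' pi_pos.le (by norm_num)]
    norm_num
  have g4 := Gamma_pos_of_pos (show (0 : ℝ) < 4 by norm_num)
  have g32 := Gamma_pos_of_pos (show (0 : ℝ) < 3 / 2 by norm_num)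
  simp only [hrank, finrank_euclideanSpace, Fintype.card_fin, pow_one] at h8 h4 h3
  norm_num [g5, g52, p32] at h8 h4 h3
  rw [integral_schmidtGap_mul_exp_neg_norm_sq, h8, h4, h3, h1] at h
  field_simp at h
  rw [Real.sq_sqrt pi_pos.le] at h
  refine mul_left_cancel₀ pi_ne_zero ?_
  linarith

/-- **Expected largest Schmidt weight of a Haar-random two-qubit state.**
Let `U` be Haar-random in `U(4)`, `ψ = U e₀ ∈ ℂ⁴`, and let `M` be the `2×2` reshaping
of `ψ`.  Then the expected largest eigenvalue of `M Mᴴ` (the largest squared Schmidt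
coefficient of `ψ`) equals `7/8`. -/
theorem expected_largest_schmidt_weight_haar_two_qubit
    [MeasurableSpace (Matrix.unitaryGroup (Fin 4) ℂ)]
    [BorelSpace (Matrix.unitaryGroup (Fin 4) ℂ)]
    (μ : Measure (Matrix.unitaryGroup (Fin 4) ℂ))
    [μ.IsHaarMeasure] [IsProbabilityMeasure μ] :
    ∫ U, lambdaMax
        (reshape2 ((U : Matrix (Fin 4) (Fin 4) ℂ) *ᵥ (Pi.single 0 1 : Fin 4 → ℂ)) *
          (reshape2 ((U : Matrix (Fin 4) (Fin 4) ℂ) *ᵥ (Pi.single 0 1 : Fin 4 → ℂ)))ᴴ)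
        (Matrix.isHermitian_mul_conjTranspose_self _) ∂μ = 7 / 8 := by
  have hnorm (U : unitaryGroup (Fin 4) ℂ) :
      ‖toIsometry (Fin 4) U (EuclideanSpace.single 0 1)‖ = 1 := by
    simp
  have hcont : Continuous fun U : unitaryGroup (Fin 4) ℂ =>
      schmidtGap (toIsometry (Fin 4) U (EuclideanSpace.single 0 1)) := by
    have h := continuous_toIsometry_apply.comp
      (Continuous.prodMk_left (EuclideanSpace.single (0 : Fin 4) (1 : ℂ)))
    exact continuous_schmidtGap.comp h
  have hint : Integrable (fun U : unitaryGroup (Fin 4) ℂ =>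
      schmidtGap (toIsometry (Fin 4) U (EuclideanSpace.single 0 1))) μ :=
    hcont.integrable_of_hasCompactSupport (HasCompactSupport.of_compactSpace _)
  calc _ = ∫ U, (1 + schmidtGap (toIsometry (Fin 4) U (EuclideanSpace.single 0 1))) / 2 ∂μ := by
        refine integral_congr_ae (.of_forall fun U => ?_)
        refine (lambdaMax_reshape2 (toIsometry (Fin 4) U (EuclideanSpace.single 0 1))).trans ?_
        rw [hnorm, one_pow]
    _ = 7 / 8 := by
        rw [integral_div, integral_add (integrable_const (1 : ℝ)) hint,
          integral_schmidtGap_toIsometry_single]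
        norm_num
end
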